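/- For all constants $0 < m_0 \le m_1$, $E > 0$, $H_0 \in \mathbb{R}$, there exists $c_0 > 0$, depending only on $m_0, m_1, E, H_0$, such that the following holds. Let $g : \mathbb{R}^3 \to [0,\infty)$ satisfy $m_0 \le \int g\,dv \le m_1$, $\int g |v|^2\,dv \le E$, $\int g \ln g\,dv \le H_0$, and $\int g|\ln g|\,dv < \infty$. Then for every $n \in \mathbb{N}\setminus\{0\}$, every truncated kernel $K_n$, every $v \in \mathbb{R}^3$, and every $\xi \in \mathbb{R}^3$, one has $A_n[g](v) : \xi \otimes \xi = \int_{\mathbb{R}^3} K_n(|v-w|)\,g(w)\,\Big(|\xi|^2 - \frac{((v-w)\cdot\xi)^2}{|v-w|^2}\Big)\,dw \;\ge\; c_0\, \langle v\rangle^{-3}\, |\xi|^2$. -/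

import Mathlib

noncomputable section

open MeasureTheory Real

abbrev E3 : Type := EuclideanSpace ℝ (Fin 3)

/-- The Japanese bracket power `⟨v⟩^r = (1+|v|^2)^(r/2)`. -/
def wt (v : E3) (r : ℝ) : ℝ := (1 + ‖v‖ ^ 2) ^ (r / 2)

/-- Weighted Lebesgue norm `‖g‖_{L^p_k}`. -/
def wnorm (p k : ℝ) (g : E3 → ℝ) : ℝ :=
  (∫ v : E3, |g v| ^ p * wt v (p * k)) ^ (1 / p)

/-- Entries of the projection matrix `Π(z)` onto the plane orthogonal to `z`. -/
def proj (z : E3) (i j : Fin 3) : ℝ :=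
  (if i = j then (1 : ℝ) else 0) - z i * z j / ‖z‖ ^ 2

/-- A truncated Coulomb kernel at level `n`. -/
def IsTruncKernel (n : ℕ) (K : ℝ → ℝ) : Prop :=
  ContDiffOn ℝ (⊤ : ℕ∞) K (Set.Ioi 0) ∧
  (∀ r : ℝ, 0 < r → 0 < K r) ∧
  (∀ r : ℝ, 1 / n ≤ r → K r = r⁻¹) ∧
  (∀ r : ℝ, 0 < r → r ≤ 1 / n → (n : ℝ) ≤ K r ∧ K r ≤ 2 * n) ∧
  (∀ r : ℝ, 0 < r → K r ≤ r⁻¹)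

/-- The `i`-th standard basis vector of `ℝ³`. -/
def e3 (i : Fin 3) : E3 := EuclideanSpace.single i 1

/-- Partial derivative in direction `i`. -/
def pd (i : Fin 3) (g : E3 → ℝ) (v : E3) : ℝ := fderiv ℝ g v (e3 i)

/-- The matrix coefficient `A_n[g]_{ij} = (K_n Π_{ij}) * g`. -/
def Acoef (K : ℝ → ℝ) (g : E3 → ℝ) (v : E3) (i j : Fin 3) : ℝ :=
  ∫ w : E3, K ‖v - w‖ * proj (v - w) i j * g w

/-- The vector coefficient `b_n[g]_i = ∑ j ∂_j(K_n Π_{ij}) * g`. -/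
def bcoef (K : ℝ → ℝ) (g : E3 → ℝ) (v : E3) (i : Fin 3) : ℝ :=
  ∫ w : E3, (∑ j : Fin 3, fderiv ℝ (fun z : E3 => K ‖z‖ * proj z i j) (v - w) (e3 j)) * g w

/-- The entropy `H(g) = ∫ g ln g`. -/
def entropy (g : E3 → ℝ) : ℝ := ∫ v : E3, g v * Real.log (g v)

/-- The entropy dissipation `D_n(g)`. -/
def entDiss (K : ℝ → ℝ) (g : E3 → ℝ) : ℝ :=
  (1 / 2) * ∫ v : E3, ∫ w : E3,
    K ‖v - w‖ * g v * g w *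
      ∑ i : Fin 3, ∑ j : Fin 3,
        (pd i g v / g v - pd i g w / g w) * proj (v - w) i j *
          (pd j g v / g v - pd j g w / g w)

/-- The Fisher information `∫ |∇g|²/g`. -/
def fisher (g : E3 → ℝ) : ℝ := ∫ v : E3, (∑ i : Fin 3, pd i g v ^ 2) / g v

/-- A standard mollifier at scale `1/n`. -/
def IsMollifier (n : ℕ) (χ : E3 → ℝ) : Prop :=
  ContDiff ℝ (⊤ : ℕ∞) χ ∧ (∀ v, 0 ≤ χ v) ∧ (∀ v, χ v ≠ 0 → ‖v‖ ≤ 1 / n) ∧ (∫ v : E3, χ v) = 1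

/-- The Gaussian `M(v) = exp(-|v|²)`. -/
def gaussM (v : E3) : ℝ := Real.exp (-‖v‖ ^ 2)

/-- The regularized initial datum `f_{in,n} = (f_in 1_{|v| ≤ n}) ⋆ χ_n + M/n`. -/
def initApprox (fi : E3 → ℝ) (n : ℕ) (χ : E3 → ℝ) (v : E3) : ℝ :=
  (∫ w : E3, (if ‖w‖ ≤ (n : ℝ) then fi w else 0) * χ (v - w)) + gaussM v / n

/-- The approximated Landau equation in divergence form. -/
def SolvesApproxLandau (n : ℕ) (K : ℝ → ℝ) (f : ℝ → E3 → ℝ) : Prop :=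
  ∀ t : ℝ, 0 ≤ t → ∀ v : E3,
    deriv (fun s => f s v) t =
      (∑ i : Fin 3, pd i (fun u =>
        (∑ j : Fin 3, Acoef K (f t) u i j * pd j (f t) u) - bcoef K (f t) u i * f t u) v)
      + (1 / n) * ∑ i : Fin 3, pd i (pd i (f t)) v

/-- A global smooth positive rapidly decaying solution of the approximated Landau
equation with regularized initial datum. -/
def IsApproxSolution (n : ℕ) (K : ℝ → ℝ) (χ : E3 → ℝ) (fi : E3 → ℝ)
    (f : ℝ → E3 → ℝ) : Prop :=
  (∀ t : ℝ, 0 ≤ t → ∀ v, 0 < f t v) ∧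
  ContDiffOn ℝ (⊤ : ℕ∞) (fun p : ℝ × E3 => f p.1 p.2) (Set.Ici 0 ×ˢ Set.univ) ∧
  (∀ t : ℝ, 0 ≤ t → ∃ F : SchwartzMap E3 ℝ, ∀ v, F v = f t v) ∧
  SolvesApproxLandau n K f ∧
  (∀ v, f 0 v = initApprox fi n χ v)

/-- The weighted relative entropy `H₃(g | M)`. -/
def H3 (g : E3 → ℝ) : ℝ :=
  ∫ v : E3, (g v * Real.log (g v) - g v + g v * ‖v‖ ^ 2 + gaussM v) * wt v 3

/-- Fenchel's inequality for the entropy function. -/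
lemma mul_sub_exp_le_mul_log {a : ℝ} (ha : 0 ≤ a) (s : ℝ) :
    a * s - exp (s - 1) ≤ a * log a := by
  rcases ha.eq_or_lt with rfl | ha
  · simp [exp_nonneg]
  · have h := add_one_le_exp (s - 1 - log a)
    rw [exp_sub, exp_log ha, le_div_iff₀ ha] at h
    linarith

lemma integrable_exp_neg_norm_sq : Integrable (fun w : E3 => exp (-‖w‖ ^ 2)) := by
  have h := GaussianFourier.integrable_cexp_neg_mul_sq_norm_add (V := E3) (b := 1)
    (by simp) 0 0
  refine h.norm.congr (Filter.Eventually.of_forall fun w => ?_)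
  simp [Complex.norm_exp, ← Complex.ofReal_pow]

/-- A nonzero vector is the direction of the first vector of some orthonormal basis. -/
lemma exists_orthonormalBasis_zero_eq {ξ : E3} (hξ : ξ ≠ 0) :
    ∃ b : OrthonormalBasis (Fin 3) ℝ E3, b 0 = ‖ξ‖⁻¹ • ξ := by
  have hn : ‖ξ‖ ≠ 0 := norm_ne_zero_iff.2 hξ
  obtain ⟨b, hb⟩ := Orthonormal.exists_orthonormalBasis_extension_of_card_eq (𝕜 := ℝ) (E := E3)
    (ι := Fin 3) (by simp) (v := fun _ => ‖ξ‖⁻¹ • ξ) (s := {0}) (by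
      refine ⟨fun i => ?_, fun i j hij => (hij (Subsingleton.elim i j)).elim⟩
      simp [Set.domRestrict, norm_smul, hn])
  exact ⟨b, hb 0 rfl⟩

/-- The part of the ball of radius `R` in the slab of half-width `η` orthogonal to `b 1`. -/
def slab (b : OrthonormalBasis (Fin 3) ℝ E3) (v : E3) (R η : ℝ) : Set E3 :=
  {w | ‖w‖ ≤ R ∧ |inner ℝ (b 1) (v - w)| ≤ η}

lemma measurableSet_slab (b : OrthonormalBasis (Fin 3) ℝ E3) (v : E3) (R η : ℝ) :
    MeasurableSet (slab b v R η) := by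
  refine IsClosed.measurableSet ?_
  have h1 : IsClosed {w : E3 | ‖w‖ ≤ R} := isClosed_le (by fun_prop) (by fun_prop)
  have h2 : IsClosed {w : E3 | |inner ℝ (b 1) (v - w)| ≤ η} :=
    isClosed_le (by fun_prop) (by fun_prop)
  exact h1.inter h2

lemma volume_slab_le (b : OrthonormalBasis (Fin 3) ℝ E3) (v : E3) {R η : ℝ}
    (hR : 0 ≤ R) (hη : 0 ≤ η) :
    volume (slab b v R η) ≤ ENNReal.ofReal (8 * R ^ 2 * η) := by
  set a := inner ℝ (b 1) v
  set l : Fin 3 → ℝ := ![-R, a - η, -R]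
  set u : Fin 3 → ℝ := ![R, a + η, R]
  have hmp := (PiLp.volume_preserving_ofLp (Fin 3)).comp b.measurePreserving_repr
  have hsub : slab b v R η ⊆
      (WithLp.ofLp ∘ b.repr) ⁻¹' (Set.Icc l u) := by
    rintro w ⟨hw, hw'⟩
    have hc : ∀ i, |inner ℝ (b i) w| ≤ R := fun i => by
      have := abs_real_inner_le_norm (b i) w
      rw [b.norm_eq_one, one_mul] at this
      exact this.trans hw
    rw [inner_sub_right, abs_le] at hw'
    have h0 := abs_le.1 (hc 0)
    have h2 := abs_le.1 (hc 2)
    simp only [Set.mem_preimage, Function.comp_apply, Set.mem_Icc, Pi.le_def, Fin.forall_fin_succ,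
      b.repr_apply_apply]
    simp [l, u]
    refine ⟨⟨?_, ?_, ?_⟩, ?_, ?_, ?_⟩ <;> linarith
  refine (measure_mono hsub).trans ?_
  rw [hmp.measure_preimage measurableSet_Icc.nullMeasurableSet, Real.volume_Icc_pi,
    Fin.prod_univ_three, ← ENNReal.ofReal_mul, ← ENNReal.ofReal_mul]
  · apply ENNReal.ofReal_le_ofReal
    simp [l, u]
    nlinarith
  all_goals simp [l, u]; try nlinarith

/-- Entropy and energy bounds prevent concentration on sets of small volume. -/
lemma mul_setIntegral_le_of_entropy {g : E3 → ℝ} (hg0 : ∀ v, 0 ≤ g v) (hg : Integrable g)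
    (hg2 : Integrable (fun v => g v * ‖v‖ ^ 2)) (hgl : Integrable (fun v => g v * log (g v)))
    {T : Set E3} (hT : MeasurableSet T) (hT' : volume T ≠ ⊤) {L : ℝ} :
    L * (∫ w in T, g w) ≤ (∫ w, g w * log (g w)) + (∫ w, g w * ‖w‖ ^ 2)
      + (∫ w : E3, exp (-‖w‖ ^ 2)) + exp L * volume.real T := by
  have hi1 : Integrable (T.indicator g) := hg.indicator hT
  have hi2 : Integrable (T.indicator (fun _ : E3 => exp L)) :=
    (integrable_indicator_iff hT).2 (integrableOn_const hT')
  have hG := integrable_exp_neg_norm_sq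
  have key : ∫ w, L * T.indicator g w ≤ ∫ w, (g w * log (g w) + g w * ‖w‖ ^ 2
      + exp (-‖w‖ ^ 2) + T.indicator (fun _ : E3 => exp L) w) := by
    refine integral_mono (hi1.const_mul L) (((hgl.add hg2).add hG).add hi2) fun w => ?_
    by_cases hw : w ∈ T
    · have h := mul_sub_exp_le_mul_log (hg0 w) (L - ‖w‖ ^ 2)
      have h1 : exp (L - ‖w‖ ^ 2 - 1) ≤ exp L := exp_le_exp.2 (by nlinarith [sq_nonneg ‖w‖])
      have h2 := exp_nonneg (-‖w‖ ^ 2)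
      simp only [Set.indicator_of_mem hw]
      linarith
    · have h := mul_sub_exp_le_mul_log (hg0 w) (- ‖w‖ ^ 2)
      have h1 : exp (- ‖w‖ ^ 2 - 1) ≤ exp (-‖w‖ ^ 2) := exp_le_exp.2 (by linarith)
      simp only [Set.indicator_of_notMem hw]
      linarith
  rw [integral_const_mul, integral_indicator hT] at key
  have e1 : ∫ w, (g w * log (g w) + g w * ‖w‖ ^ 2
      + exp (-‖w‖ ^ 2) + T.indicator (fun _ : E3 => exp L) w) =
      (∫ w, g w * log (g w)) + (∫ w, g w * ‖w‖ ^ 2)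
      + (∫ w : E3, exp (-‖w‖ ^ 2)) + ∫ w, T.indicator (fun _ : E3 => exp L) w := by
    have h12 : Integrable (fun w => g w * log (g w) + g w * ‖w‖ ^ 2) := hgl.add hg2
    have h123 : Integrable (fun w => g w * log (g w) + g w * ‖w‖ ^ 2 + exp (-‖w‖ ^ 2)) :=
      h12.add hG
    rw [integral_add h123 hi2, integral_add h12 hG, integral_add hgl hg2]
  rw [e1, integral_indicator hT, setIntegral_const, smul_eq_mul] at key
  linarith

lemma IsTruncKernel.inv_le {n : ℕ} (hn : 0 < n) {K : ℝ → ℝ} (hK : IsTruncKernel n K)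
    {r ρ : ℝ} (hr : 0 < r) (hrρ : r ≤ ρ) (hρ : 1 ≤ ρ) : ρ⁻¹ ≤ K r := by
  obtain ⟨-, -, h1, h2, -⟩ := hK
  rcases le_total (1 / (n : ℝ)) r with h | h
  · rw [h1 r h]
    exact inv_anti₀ hr hrρ
  · have : (1 : ℝ) ≤ n := by exact_mod_cast hn
    exact ((inv_le_one_of_one_le₀ hρ).trans this).trans (h2 r hr h).1

lemma IsTruncKernel.le_two_mul {n : ℕ} (hn : 0 < n) {K : ℝ → ℝ} (hK : IsTruncKernel n K)
    {r : ℝ} (hr : 0 < r) : K r ≤ 2 * n := by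
  obtain ⟨-, -, h1, h2, -⟩ := hK
  have hn' : (0 : ℝ) < n := by exact_mod_cast hn
  rcases le_total (1 / (n : ℝ)) r with h | h
  · rw [h1 r h, inv_le_comm₀ hr (by positivity)]
    refine le_trans ?_ h
    rw [← one_div]
    exact one_div_le_one_div_of_le hn' (by linarith)
  · exact (h2 r hr h).2

lemma ae_sub_ne_zero (v : E3) : ∀ᵐ w : E3, 0 < ‖v - w‖ := by
  filter_upwards [Measure.ae_ne volume v] with w hw
  exact norm_pos_iff.2 (sub_ne_zero.2 hw.symm)

lemma IsTruncKernel.aestronglyMeasurable {n : ℕ} {K : ℝ → ℝ} (hK : IsTruncKernel n K) (v : E3) :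
    AEStronglyMeasurable (fun w : E3 => K ‖v - w‖) := by
  rw [← restrict_compl_singleton (μ := (volume : Measure E3)) v]
  refine ContinuousOn.aestronglyMeasurable ?_ (measurableSet_singleton v).compl
  refine hK.1.continuousOn.comp (by fun_prop) fun w hw => ?_
  exact norm_pos_iff.2 (sub_ne_zero.2 fun h => hw (by simp [h]))

lemma abs_proj_le (z : E3) (i j : Fin 3) : |proj z i j| ≤ 2 := by
  have h1 : |(if i = j then (1 : ℝ) else 0)| ≤ 1 := by split_ifs <;> simp
  have h2 : |z i * z j / ‖z‖ ^ 2| ≤ 1 := by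
    have hi := PiLp.norm_apply_le z i
    have hj := PiLp.norm_apply_le z j
    rw [Real.norm_eq_abs] at hi hj
    rw [abs_div, abs_mul, abs_of_nonneg (sq_nonneg ‖z‖)]
    refine div_le_one_of_le₀ ?_ (sq_nonneg _)
    rw [sq]
    exact mul_le_mul hi hj (abs_nonneg _) (norm_nonneg _)
  exact (abs_sub _ _).trans (by linarith)

lemma IsTruncKernel.integrable_mul_proj {n : ℕ} (hn : 0 < n) {K : ℝ → ℝ}
    (hK : IsTruncKernel n K) {g : E3 → ℝ} (hg : Integrable g) (v : E3) (i j : Fin 3) :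
    Integrable (fun w : E3 => K ‖v - w‖ * proj (v - w) i j * g w) := by
  refine hg.bdd_mul (c := 2 * n * 2) ?_ ?_
  · refine (hK.aestronglyMeasurable v).mul (Measurable.aestronglyMeasurable ?_)
    unfold proj
    fun_prop
  · filter_upwards [ae_sub_ne_zero v] with w hw
    rw [norm_mul, Real.norm_eq_abs, Real.norm_eq_abs, abs_of_pos (hK.2.1 _ hw)]
    exact mul_le_mul (hK.le_two_mul hn hw) (abs_proj_le _ _ _) (abs_nonneg _) (by positivity)

lemma sum_proj_mul (z ξ : E3) :
    ∑ i : Fin 3, ∑ j : Fin 3, proj z i j * ξ i * ξ j =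
      ‖ξ‖ ^ 2 - (∑ i : Fin 3, z i * ξ i) ^ 2 / ‖z‖ ^ 2 := by
  rw [EuclideanSpace.norm_sq_eq ξ]
  simp only [proj, Fin.sum_univ_three, Real.norm_eq_abs, sq_abs, Fin.reduceEq, if_true, if_false]
  ring

lemma integrand_eq_sum_proj (K : ℝ → ℝ) (g : E3 → ℝ) (v ξ w : E3) :
    K ‖v - w‖ * g w * (‖ξ‖ ^ 2 - (∑ i : Fin 3, (v - w) i * ξ i) ^ 2 / ‖v - w‖ ^ 2) =
      ∑ i : Fin 3, ∑ j : Fin 3, K ‖v - w‖ * proj (v - w) i j * g w * ξ i * ξ j := by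
  rw [← sum_proj_mul, Finset.mul_sum]
  refine Finset.sum_congr rfl fun i _ => ?_
  rw [Finset.mul_sum]
  exact Finset.sum_congr rfl fun j _ => by ring

/-- The projection onto the orthogonal complement of `z` is bounded below through the component
of `z` along a unit vector orthogonal to `ξ`. -/
lemma le_norm_sq_sub_of_basis {ξ : E3} (hξ : ξ ≠ 0) {b : OrthonormalBasis (Fin 3) ℝ E3}
    (hb : b 0 = ‖ξ‖⁻¹ • ξ) {z : E3} (hz : z ≠ 0) :
    ‖ξ‖ ^ 2 * inner ℝ (b 1) z ^ 2 / ‖z‖ ^ 2 ≤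
      ‖ξ‖ ^ 2 - (∑ i : Fin 3, z i * ξ i) ^ 2 / ‖z‖ ^ 2 := by
  have hx : 0 < ‖ξ‖ := norm_pos_iff.2 hξ
  have hzp : 0 < ‖z‖ := norm_pos_iff.2 hz
  have hs : ∑ i : Fin 3, z i * ξ i = ‖ξ‖ * inner ℝ (b 0) z := by
    rw [hb, real_inner_smul_left, mul_inv_cancel_left₀ hx.ne']
    simp [PiLp.inner_apply]
  have hn := b.sum_sq_norm_inner_right z
  simp only [Fin.sum_univ_three, Real.norm_eq_abs, sq_abs] at hn
  rw [hs, le_sub_iff_add_le, ← add_div, div_le_iff₀ (by positivity), ← hn]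
  nlinarith [mul_nonneg (sq_nonneg ‖ξ‖) (sq_nonneg (inner ℝ (b 2) z))]

lemma norm_sq_sub_nonneg (z ξ : E3) :
    0 ≤ ‖ξ‖ ^ 2 - (∑ i : Fin 3, z i * ξ i) ^ 2 / ‖z‖ ^ 2 := by
  have hs : ∑ i : Fin 3, z i * ξ i = inner ℝ ξ z := by simp [PiLp.inner_apply]
  rw [hs, sub_nonneg]
  refine div_le_of_le_mul₀ (sq_nonneg _) (sq_nonneg _) ?_
  rw [← mul_pow, ← sq_abs]
  exact pow_le_pow_left₀ (abs_nonneg _) (abs_real_inner_le_norm ξ z) 2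

/-- Weight comparison: `|v| + R ≤ 2 R ⟨v⟩`. -/
lemma wt_neg_three_le (v : E3) {R : ℝ} (hR : 1 ≤ R) :
    wt v (-3) / (8 * R ^ 3) ≤ ((‖v‖ + R) ^ 3)⁻¹ := by
  set s := √(1 + ‖v‖ ^ 2)
  have hs2 : s ^ 2 = 1 + ‖v‖ ^ 2 := Real.sq_sqrt (by positivity)
  have hs0 : 0 < s := Real.sqrt_pos.2 (by positivity)
  have hw : wt v (-3) = (s ^ 3)⁻¹ := by
    rw [wt, ← hs2, ← Real.rpow_natCast, ← Real.rpow_mul hs0.le, ← Real.rpow_natCast,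
      ← Real.rpow_neg hs0.le]
    norm_num
  have hv := norm_nonneg v
  have h1 : ‖v‖ ≤ s := Real.le_sqrt_of_sq_le (by linarith)
  have h2 : 1 ≤ s := Real.one_le_sqrt.2 (by nlinarith)
  have h3 : ‖v‖ + R ≤ 2 * R * s := by nlinarith
  rw [hw, div_eq_mul_inv, ← mul_inv]
  refine inv_anti₀ (by positivity) ?_
  calc (‖v‖ + R) ^ 3 ≤ (2 * R * s) ^ 3 := pow_le_pow_left₀ (by positivity) h3 3
    _ = s ^ 3 * (8 * R ^ 3) := by ring

lemma IsTruncKernel.le_integrand {n : ℕ} (hn : 0 < n) {K : ℝ → ℝ} (hK : IsTruncKernel n K)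
    {ξ : E3} (hξ : ξ ≠ 0) {b : OrthonormalBasis (Fin 3) ℝ E3} (hb : b 0 = ‖ξ‖⁻¹ • ξ)
    {R η : ℝ} (hR : 1 ≤ R) (hη : 0 ≤ η) {g : E3 → ℝ} (hg0 : ∀ v, 0 ≤ g v) {v w : E3}
    (hw : 0 < ‖v - w‖) :
    η ^ 2 * (wt v (-3) / (8 * R ^ 3)) * ‖ξ‖ ^ 2 *
        (g w - g w * ‖w‖ ^ 2 / R ^ 2 - (slab b v R η).indicator g w) ≤
      K ‖v - w‖ * g w * (‖ξ‖ ^ 2 - (∑ i : Fin 3, (v - w) i * ξ i) ^ 2 / ‖v - w‖ ^ 2) := by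
  have hg := hg0 w
  have hKp := hK.2.1 _ hw
  have hq := norm_sq_sub_nonneg (v - w) ξ
  have hwt : 0 ≤ wt v (-3) := by unfold wt; positivity
  have hc : 0 ≤ η ^ 2 * (wt v (-3) / (8 * R ^ 3)) * ‖ξ‖ ^ 2 := by positivity
  have hrhs := mul_nonneg (mul_nonneg hKp.le hg) hq
  have hR0 : 0 < R := by linarith
  by_cases hwR : ‖w‖ ≤ R
  swap
  · refine le_trans (mul_nonpos_of_nonneg_of_nonpos hc ?_) hrhs
    have h1 : g w ≤ g w * ‖w‖ ^ 2 / R ^ 2 := by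
      rw [le_div_iff₀ (by positivity)]
      gcongr
      linarith
    have h2 : 0 ≤ (slab b v R η).indicator g w := Set.indicator_nonneg (fun w _ => hg0 w) w
    linarith
  have h1 : 0 ≤ g w * ‖w‖ ^ 2 / R ^ 2 := by positivity
  by_cases hwT : w ∈ slab b v R η
  · refine le_trans (mul_nonpos_of_nonneg_of_nonpos hc ?_) hrhs
    rw [Set.indicator_of_mem hwT]
    linarith
  have ht : η < |inner ℝ (b 1) (v - w)| := by
    by_contra! h
    exact hwT ⟨hwR, h⟩
  have ht2 : η ^ 2 ≤ inner ℝ (b 1) (v - w) ^ 2 := by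
    rw [← sq_abs (inner ℝ (b 1) (v - w))]
    exact pow_le_pow_left₀ hη ht.le 2
  have hrρ : ‖v - w‖ ≤ ‖v‖ + R := (norm_sub_le _ _).trans (by linarith)
  have hρ : 1 ≤ ‖v‖ + R := by linarith [norm_nonneg v]
  have hρ0 : 0 < ‖v‖ + R := by linarith
  have hK1 := hK.inv_le hn hw hrρ hρ
  have hq1 : ‖ξ‖ ^ 2 * η ^ 2 / (‖v‖ + R) ^ 2 ≤
      ‖ξ‖ ^ 2 - (∑ i : Fin 3, (v - w) i * ξ i) ^ 2 / ‖v - w‖ ^ 2 :=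
    le_trans (by gcongr) (le_norm_sq_sub_of_basis hξ hb (norm_pos_iff.1 hw))
  rw [Set.indicator_of_notMem hwT]
  calc _ ≤ η ^ 2 * (wt v (-3) / (8 * R ^ 3)) * ‖ξ‖ ^ 2 * g w :=
        mul_le_mul_of_nonneg_left (by linarith) hc
    _ ≤ η ^ 2 * ((‖v‖ + R) ^ 3)⁻¹ * ‖ξ‖ ^ 2 * g w := by
        gcongr
        exact wt_neg_three_le v hR
    _ = (‖v‖ + R)⁻¹ * g w * (‖ξ‖ ^ 2 * η ^ 2 / (‖v‖ + R) ^ 2) := by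
        field_simp
    _ ≤ _ := by gcongr

/-- Coercivity of the truncated diffusion matrix: for `g` with mass in `[m₀,m₁]`, energy
at most `E`, entropy at most `H₀` and `∫ g|ln g| < ∞`, one has
`A_n[g](v) : ξ⊗ξ = ∫ K_n(|v-w|) g(w) (|ξ|² - ((v-w)·ξ)²/|v-w|²) dw ≥ c₀ ⟨v⟩⁻³ |ξ|²`,
with `c₀` depending only on `m₀, m₁, E, H₀`. -/
theorem coercivity_A (m0 m1 En H0 : ℝ) (hm0 : 0 < m0) (hm01 : m0 ≤ m1) (hE : 0 < En) :
    ∃ c0 : ℝ, 0 < c0 ∧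
      ∀ g : E3 → ℝ, (∀ v, 0 ≤ g v) →
        Integrable g → Integrable (fun v => g v * ‖v‖ ^ 2) →
        Integrable (fun v => g v * Real.log (g v)) →
        m0 ≤ (∫ v : E3, g v) → (∫ v : E3, g v) ≤ m1 →
        (∫ v : E3, g v * ‖v‖ ^ 2) ≤ En →
        (∫ v : E3, g v * Real.log (g v)) ≤ H0 →
        ∀ (n : ℕ), 0 < n → ∀ K : ℝ → ℝ, IsTruncKernel n K →
        ∀ v ξ : E3,
          ((∑ i : Fin 3, ∑ j : Fin 3, Acoef K g v i j * ξ i * ξ j) =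
              ∫ w : E3, K ‖v - w‖ * g w *
                (‖ξ‖ ^ 2 - (∑ i : Fin 3, (v - w) i * ξ i) ^ 2 / ‖v - w‖ ^ 2)) ∧
          c0 * wt v (-3) * ‖ξ‖ ^ 2 ≤
            ∫ w : E3, K ‖v - w‖ * g w *
              (‖ξ‖ ^ 2 - (∑ i : Fin 3, (v - w) i * ξ i) ^ 2 / ‖v - w‖ ^ 2) := by
  set G := ∫ w : E3, exp (-‖w‖ ^ 2)
  have hG : 0 ≤ G := integral_nonneg fun w => exp_nonneg _
  set R := 1 + 4 * En / m0
  have hR : 1 ≤ R := le_add_of_nonneg_right (by positivity)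
  have hR0 : 0 < R := by linarith
  set L := 4 * (|H0| + En + G + 1) / m0
  have hL : 0 < L := by positivity
  set η := exp (-L) / (8 * R ^ 2)
  have hη : 0 < η := by positivity
  refine ⟨η ^ 2 / (8 * R ^ 3) * (m0 / 2), by positivity, ?_⟩
  intro g hg0 hg hg2 hgl hm _ hE2 hH n hn K hK v ξ
  have hint : ∀ i j : Fin 3,
      Integrable (fun w => K ‖v - w‖ * proj (v - w) i j * g w * ξ i * ξ j) := fun i j =>
    ((hK.integrable_mul_proj hn hg v i j).mul_const _).mul_const _
  simp_rw [integrand_eq_sum_proj K g v ξ]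
  constructor
  · rw [integral_finsetSum _ fun i _ => integrable_finsetSum _ fun j _ => hint i j]
    refine Finset.sum_congr rfl fun i _ => ?_
    rw [integral_finsetSum _ fun j _ => hint i j]
    refine Finset.sum_congr rfl fun j _ => ?_
    rw [integral_mul_const, integral_mul_const, Acoef]
  rcases eq_or_ne ξ 0 with rfl | hξ
  · simp
  obtain ⟨b, hb⟩ := exists_orthonormalBasis_zero_eq hξ
  set T := slab b v R η
  have hTm : MeasurableSet T := measurableSet_slab b v R η
  have hTv := volume_slab_le b v hR0.le hη.le
  have hTr : exp L * volume.real T ≤ 1 := by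
    have h1 : volume.real T ≤ 8 * R ^ 2 * η := ENNReal.toReal_le_of_le_ofReal (by positivity) hTv
    calc exp L * volume.real T ≤ exp L * (8 * R ^ 2 * η) := by gcongr
      _ = exp L * exp (-L) := by simp only [η]; field_simp
      _ = 1 := by rw [← exp_add]; simp
  have hTg : ∫ w in T, g w ≤ m0 / 4 := by
    have h := mul_setIntegral_le_of_entropy hg0 hg hg2 hgl hTm
      (hTv.trans_lt ENNReal.ofReal_lt_top).ne (L := L)
    have h2 : L * (∫ w in T, g w) ≤ L * (m0 / 4) := by
      have h3 : L * (m0 / 4) = |H0| + En + G + 1 := by simp only [L]; field_simp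
      linarith [le_abs_self H0]
    exact le_of_mul_le_mul_left h2 hL
  have hER : (∫ w, g w * ‖w‖ ^ 2) / R ^ 2 ≤ m0 / 4 := by
    rw [div_le_iff₀ (by positivity)]
    have h1 : m0 * R = m0 + 4 * En := by simp only [R]; field_simp
    nlinarith
  have hi : Integrable (fun w => g w - g w * ‖w‖ ^ 2 / R ^ 2 - T.indicator g w) :=
    (hg.sub (hg2.div_const _)).sub (hg.indicator hTm)
  have hmass : m0 / 2 ≤ ∫ w, (g w - g w * ‖w‖ ^ 2 / R ^ 2 - T.indicator g w) := by
    have h12 : Integrable (fun w => g w - g w * ‖w‖ ^ 2 / R ^ 2) := hg.sub (hg2.div_const _)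
    rw [integral_sub h12 (hg.indicator hTm),
      integral_sub hg (hg2.div_const _), integral_div, integral_indicator hTm]
    linarith
  have hwt : 0 ≤ wt v (-3) := by unfold wt; positivity
  calc η ^ 2 / (8 * R ^ 3) * (m0 / 2) * wt v (-3) * ‖ξ‖ ^ 2
      = η ^ 2 * (wt v (-3) / (8 * R ^ 3)) * ‖ξ‖ ^ 2 * (m0 / 2) := by ring
    _ ≤ η ^ 2 * (wt v (-3) / (8 * R ^ 3)) * ‖ξ‖ ^ 2 *
        ∫ w, (g w - g w * ‖w‖ ^ 2 / R ^ 2 - T.indicator g w) := by gcongr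
    _ = ∫ w, η ^ 2 * (wt v (-3) / (8 * R ^ 3)) * ‖ξ‖ ^ 2 *
        (g w - g w * ‖w‖ ^ 2 / R ^ 2 - T.indicator g w) := (integral_const_mul _ _).symm
    _ ≤ _ := by
      refine integral_mono_ae (hi.const_mul _)
        (integrable_finsetSum _ fun i _ => integrable_finsetSum _ fun j _ => hint i j) ?_
      filter_upwards [ae_sub_ne_zero v] with w hw
      rw [← integrand_eq_sum_proj K g v ξ w]
      exact hK.le_integrand hn hξ hb hR hη.le hg0 hw
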